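/- Let 0 < p ≤ q with p > 1 and 0 < r ≤ s with r ≤ 1. If f : S_{p,q} → S_{r,s} is a surjective α-Hölder map, then α ≤ (1+s)/(2+s−r). -/

import Mathlib

open Set Metric MeasureTheory

noncomputable def spiral (p q : ℝ) : Set ℂ :=
  {z : ℂ | ∃ t : ℝ, 1 < t ∧
    z = (t ^ (-p) * Real.cos t : ℝ) + (t ^ (-q) * Real.sin t : ℝ) * Complex.I}

/-- `f` is `α`-Hölder on the set `A`. -/
def HolderOnSet (f : ℂ → ℂ) (α : ℝ) (A : Set ℂ) : Prop :=
  ∃ c : ℝ, 0 < c ∧ ∀ x ∈ A, ∀ y ∈ A, dist (f x) (f y) ≤ c * dist x y ^ α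
namespace Real

lemma mul_rpow_neg_mul_sub_le {a b σ : ℝ} (ha : 0 < a) (hb : 0 < b) (hσ : 0 < σ) :
    σ * b ^ (-(σ + 1)) * (b - a) ≤ a ^ (-σ) - b ^ (-σ) := by
  have hab : 0 < a / b := div_pos ha hb
  have h1 : 1 + σ * (1 - a / b) ≤ (a / b) ^ (-σ) := by
    rw [rpow_def_of_pos hab]
    have h2 := add_one_le_exp (log (a / b) * -σ)
    have h3 := log_le_sub_one_of_pos hab
    nlinarith
  have h4 : a ^ (-σ) = (a / b) ^ (-σ) * b ^ (-σ) := by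
    rw [← mul_rpow hab.le hb.le, div_mul_cancel₀ a hb.ne']
  have h5 : b ^ (-σ) = b ^ (-(σ + 1)) * b := by
    rw [← rpow_add_one hb.ne']
    ring_nf
  have h6 : 0 < b ^ (-σ) := rpow_pos_of_pos hb _
  have h7 := mul_le_mul_of_nonneg_right h1 h6.le
  have h8 : (1 + σ * (1 - a / b)) * b ^ (-σ) =
      b ^ (-σ) + σ * b ^ (-(σ + 1)) * (b - a) := by
    rw [h5]
    field_simp
  linarith

lemma le_of_rpow_le_const_mul_rpow {u v B : ℝ}
    (h : ∀ K : ℕ, 1 ≤ K → (16 * (K : ℝ)) ^ u ≤ B * (16 * (K : ℝ)) ^ v) : u ≤ v := by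
  by_contra! huv
  have ht : Filter.Tendsto (fun K : ℕ => (16 * (K : ℝ)) ^ (u - v)) Filter.atTop Filter.atTop :=
    (tendsto_rpow_atTop (sub_pos.2 huv)).comp
      (tendsto_natCast_atTop_atTop.const_mul_atTop (by norm_num))
  obtain ⟨K, hKB, hK⟩ :=
    ((ht.eventually_gt_atTop B).and (Filter.eventually_ge_atTop 1)).exists
  have hX : 0 < 16 * (K : ℝ) := by
    have : (0 : ℝ) < K := by exact_mod_cast hK
    positivity
  have := h K hK
  rw [rpow_sub hX, lt_div_iff₀ (rpow_pos_of_pos hX v)] at hKB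
  linarith

end Real

/-- A `δ`-separated family of reals in `[0, L]` has at most `L / δ + 1` members. -/
lemma card_le_of_separated {ι : Type*} (S : Finset ι) (g : ι → ℝ) {L δ : ℝ} (hL : 0 ≤ L)
    (hδ : 0 < δ) (h0 : ∀ i ∈ S, 0 ≤ g i) (h1 : ∀ i ∈ S, g i ≤ L)
    (hsep : ∀ i ∈ S, ∀ j ∈ S, i ≠ j → δ ≤ |g i - g j|) : (S.card : ℝ) ≤ L / δ + 1 := by
  have hcard : S.card ≤ (Finset.range (⌊L / δ⌋₊ + 1)).card := by
    refine Finset.card_le_card_of_injOn (fun i => ⌊g i / δ⌋₊) ?_ ?_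
    · intro i hi
      simp only [Finset.coe_range, Set.mem_Iio]
      exact Nat.lt_succ_of_le (Nat.floor_mono (by gcongr; exact h1 i hi))
    · intro i hi j hj hij
      by_contra hne
      have hi1 := Nat.floor_le (div_nonneg (h0 i hi) hδ.le)
      have hi2 := Nat.lt_floor_add_one (g i / δ)
      have hj1 := Nat.floor_le (div_nonneg (h0 j hj) hδ.le)
      have hj2 := Nat.lt_floor_add_one (g j / δ)
      simp only at hij
      rw [hij] at hi1 hi2
      have hlt : |g i / δ - g j / δ| < 1 := abs_lt.2 ⟨by linarith, by linarith⟩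
      rw [← sub_div, abs_div, abs_of_pos hδ, div_lt_one hδ] at hlt
      exact absurd (hsep i hi j hj hne) (not_le.2 hlt)
  rw [Finset.card_range] at hcard
  calc (S.card : ℝ) ≤ ((⌊L / δ⌋₊ + 1 : ℕ) : ℝ) := by exact_mod_cast hcard
    _ = (⌊L / δ⌋₊ : ℝ) + 1 := by push_cast; ring
    _ ≤ L / δ + 1 := by gcongr; exact Nat.floor_le (by positivity)

/-- The parametrization of `spiral p q`. -/
noncomputable def spiralPoint (p q t : ℝ) : ℂ :=
  (t ^ (-p) * Real.cos t : ℝ) + (t ^ (-q) * Real.sin t : ℝ) * Complex.I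

lemma spiralPoint_re (p q t : ℝ) : (spiralPoint p q t).re = t ^ (-p) * Real.cos t := by
  simp [spiralPoint, -Complex.ofReal_mul, -Complex.ofReal_cos, -Complex.ofReal_sin]

lemma spiralPoint_im (p q t : ℝ) : (spiralPoint p q t).im = t ^ (-q) * Real.sin t := by
  simp [spiralPoint, -Complex.ofReal_mul, -Complex.ofReal_cos, -Complex.ofReal_sin]

lemma abs_rpow_neg_mul_sub_le {p q a b : ℝ} {φ : ℝ → ℝ} (hp1 : 1 < p) (hpq : p ≤ q)
    (hφ1 : ∀ x, |φ x| ≤ 1) (hφ : ∀ x y, |φ x - φ y| ≤ |x - y|) (ha : 1 < a) (hab : a ≤ b) :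
    |a ^ (-q) * φ a - b ^ (-q) * φ b| ≤
      a ^ (-q) - b ^ (-q) + (a ^ (-(p - 1)) - b ^ (-(p - 1))) / (p - 1) := by
  have ha0 : 0 < a := by linarith
  have hb0 : 0 < b := by linarith
  have h1 : b ^ (-q) ≤ a ^ (-q) :=
    Real.rpow_le_rpow_of_nonpos ha0 hab (by linarith)
  have h2 : b ^ (-q) ≤ b ^ (-p) :=
    Real.rpow_le_rpow_of_exponent_le (by linarith) (by linarith)
  have h3 := Real.mul_rpow_neg_mul_sub_le ha0 hb0 (sub_pos.2 hp1)
  rw [sub_add_cancel, mul_assoc] at h3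
  have h4 : b ^ (-p) * (b - a) ≤ (a ^ (-(p - 1)) - b ^ (-(p - 1))) / (p - 1) := by
    rw [le_div_iff₀ (sub_pos.2 hp1)]
    linarith
  have h5 : b ^ (-q) * |φ a - φ b| ≤ b ^ (-p) * (b - a) := by
    have : |φ a - φ b| ≤ b - a := by
      have := hφ a b
      rwa [abs_sub_comm a b, abs_of_nonneg (sub_nonneg.2 hab)] at this
    have : 0 ≤ b ^ (-p) := (Real.rpow_pos_of_pos hb0 _).le
    gcongr
  have h6 : (a ^ (-q) - b ^ (-q)) * |φ a| ≤ a ^ (-q) - b ^ (-q) :=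
    mul_le_of_le_one_right (sub_nonneg.2 h1) (hφ1 a)
  calc |a ^ (-q) * φ a - b ^ (-q) * φ b|
      = |(a ^ (-q) - b ^ (-q)) * φ a + b ^ (-q) * (φ a - φ b)| := by ring_nf
    _ ≤ |(a ^ (-q) - b ^ (-q)) * φ a| + |b ^ (-q) * (φ a - φ b)| := abs_add_le _ _
    _ = (a ^ (-q) - b ^ (-q)) * |φ a| + b ^ (-q) * |φ a - φ b| := by
      rw [abs_mul, abs_mul, abs_of_nonneg (sub_nonneg.2 h1),
        abs_of_pos (Real.rpow_pos_of_pos hb0 _)]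
    _ ≤ _ := by linarith

/-- A decreasing function of the parameter whose increments dominate distances along
`spiral p q` when `1 < p`. -/
noncomputable def spiralGauge (p q t : ℝ) : ℝ :=
  t ^ (-p) + t ^ (-q) + 2 * (t ^ (-(p - 1)) / (p - 1))

lemma spiralGauge_nonneg {p t : ℝ} (q : ℝ) (hp1 : 1 < p) (ht : 1 < t) :
    0 ≤ spiralGauge p q t := by
  have := sub_pos.2 hp1
  unfold spiralGauge
  positivity

lemma spiralGauge_le {p q t : ℝ} (hp1 : 1 < p) (hpq : p ≤ q) (ht : 1 < t) :
    spiralGauge p q t ≤ 2 + 2 / (p - 1) := by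
  have hp := sub_pos.2 hp1
  have h1 : t ^ (-p) ≤ 1 := Real.rpow_le_one_of_one_le_of_nonpos ht.le (by linarith)
  have h2 : t ^ (-q) ≤ 1 := Real.rpow_le_one_of_one_le_of_nonpos ht.le (by linarith)
  have h3 : t ^ (-(p - 1)) ≤ 1 := Real.rpow_le_one_of_one_le_of_nonpos ht.le (by linarith)
  have h4 : t ^ (-(p - 1)) / (p - 1) ≤ 1 / (p - 1) := by gcongr
  have h5 : 2 / (p - 1) = 2 * (1 / (p - 1)) := by ring
  unfold spiralGauge
  linarith

lemma dist_spiralPoint_le {p q a b : ℝ} (hp1 : 1 < p) (hpq : p ≤ q) (ha : 1 < a) (hb : 1 < b) :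
    dist (spiralPoint p q a) (spiralPoint p q b) ≤ |spiralGauge p q a - spiralGauge p q b| := by
  wlog hab : a ≤ b generalizing a b
  · rw [dist_comm, abs_sub_comm]
    exact this hb ha (le_of_not_ge hab)
  have h1 := abs_rpow_neg_mul_sub_le (φ := Real.cos) hp1 le_rfl Real.abs_cos_le_one
    (fun x y => by simpa [Real.dist_eq] using Real.lipschitzWith_cos.dist_le_mul x y) ha hab
  have h2 := abs_rpow_neg_mul_sub_le (φ := Real.sin) hp1 hpq Real.abs_sin_le_one
    (fun x y => by simpa [Real.dist_eq] using Real.lipschitzWith_sin.dist_le_mul x y) ha hab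
  have h3 := Complex.norm_le_abs_re_add_abs_im (spiralPoint p q a - spiralPoint p q b)
  rw [Complex.sub_re, Complex.sub_im, spiralPoint_re, spiralPoint_re, spiralPoint_im,
    spiralPoint_im] at h3
  rw [Complex.dist_eq]
  refine le_trans ?_ (le_abs_self _)
  unfold spiralGauge
  rw [sub_div] at h1 h2
  linarith

/-- On the `k`-th turn, the spiral meets every vertical line close enough to the imaginary axis
at a parameter close to `2πk + π/2`. -/
lemma exists_param_on_turn {r x : ℝ} {k K : ℕ} (hr : 0 < r) (hkK : k < 2 * K) (hk : 1 ≤ k)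
    (hx0 : 0 ≤ x) (hx : x ≤ (16 * (K : ℝ)) ^ (-r) / 2) :
    ∃ θ ∈ Icc (Real.pi / 6) (Real.pi / 2),
      (2 * Real.pi * k + θ) ^ (-r) * Real.cos θ = x := by
  have hk1 : (1 : ℝ) ≤ k := by exact_mod_cast hk
  have hkK1 : (k : ℝ) + 1 ≤ 2 * K := by exact_mod_cast hkK
  have hpi := Real.pi_pos
  have hcont : ContinuousOn (fun θ : ℝ => (2 * Real.pi * k + θ) ^ (-r) * Real.cos θ)
      (Icc (Real.pi / 6) (Real.pi / 2)) := by
    refine ContinuousOn.mul (ContinuousOn.rpow_const (by fun_prop) ?_)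
      Real.continuous_cos.continuousOn
    intro θ hθ
    left
    have : 0 < θ := (by positivity : 0 < Real.pi / 6).trans_le hθ.1
    positivity
  have hIVT := intermediate_value_Icc' (by linarith) hcont
  refine hIVT ⟨?_, ?_⟩
  · simpa using hx0
  · refine hx.trans ?_
    have h1 : (16 * (K : ℝ)) ^ (-r) ≤ (2 * Real.pi * k + Real.pi / 6) ^ (-r) := by
      refine Real.rpow_le_rpow_of_nonpos (by positivity) ?_ (by linarith)
      have := Real.pi_le_four
      nlinarith
    have h2 : (1 : ℝ) / 2 ≤ Real.cos (Real.pi / 6) := by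
      rw [Real.cos_pi_div_six]
      have : (1 : ℝ) ≤ √3 := Real.one_le_sqrt.2 (by norm_num)
      linarith
    have h3 : 0 < (16 * (K : ℝ)) ^ (-r) := Real.rpow_pos_of_pos (by linarith) _
    rw [div_eq_mul_one_div]
    gcongr

/-- Points of distinct turns with equal real part are vertically separated. -/
lemma vertical_separation {r s θ₁ θ₂ : ℝ} {k₁ k₂ K : ℕ} (hr : 0 < r) (hs : 0 < s)
    (hk₁ : 1 ≤ k₁) (hk : k₁ < k₂) (hk₂ : k₂ < 2 * K)
    (hθ₁ : θ₁ ∈ Icc (Real.pi / 6) (Real.pi / 2)) (hθ₂ : θ₂ ∈ Icc (Real.pi / 6) (Real.pi / 2))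
    (heq : (2 * Real.pi * k₁ + θ₁) ^ (-r) * Real.cos θ₁ =
      (2 * Real.pi * k₂ + θ₂) ^ (-r) * Real.cos θ₂) :
    s / 2 * (16 * (K : ℝ)) ^ (-(s + 1)) ≤
      (2 * Real.pi * k₁ + θ₁) ^ (-s) * Real.sin θ₁ -
        (2 * Real.pi * k₂ + θ₂) ^ (-s) * Real.sin θ₂ := by
  obtain ⟨hl₁, hu₁⟩ := hθ₁
  obtain ⟨hl₂, hu₂⟩ := hθ₂
  have hpi := Real.pi_gt_three
  have hpi4 := Real.pi_le_four
  have hk1 : (1 : ℝ) ≤ k₁ := by exact_mod_cast hk₁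
  have hk' : (k₁ : ℝ) + 1 ≤ k₂ := by exact_mod_cast hk
  have hk2 : (k₂ : ℝ) + 1 ≤ 2 * K := by exact_mod_cast hk₂
  have hθ₁0 : 0 < θ₁ := by linarith
  set a := 2 * Real.pi * k₁ + θ₁ with ha
  set b := 2 * Real.pi * k₂ + θ₂ with hb
  have ha0 : 0 < a := by positivity
  have hab : 1 ≤ b - a := by nlinarith
  have hb0 : 0 < b := by linarith
  have hbK : b ≤ 16 * K := by nlinarith
  have hrab : b ^ (-r) ≤ a ^ (-r) :=
    Real.rpow_le_rpow_of_nonpos ha0 (by linarith) (by linarith)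
  have hc1 : 0 ≤ Real.cos θ₁ := Real.cos_nonneg_of_neg_pi_div_two_le_of_le (by linarith) hu₁
  have hbr : 0 < b ^ (-r) := Real.rpow_pos_of_pos hb0 _
  have hcos : Real.cos θ₁ ≤ Real.cos θ₂ := by
    have := mul_le_mul_of_nonneg_right hrab hc1
    rw [heq] at this
    exact le_of_mul_le_mul_left this hbr
  have hθ : θ₂ ≤ θ₁ := by
    by_contra! h
    exact absurd hcos (not_le.2 (Real.cos_lt_cos_of_nonneg_of_le_pi (by linarith) (by linarith) h))
  have hsin : Real.sin θ₂ ≤ Real.sin θ₁ :=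
    Real.sin_le_sin_of_le_of_le_pi_div_two (by linarith) hu₁ hθ
  have hsin2 : 1 / 2 ≤ Real.sin θ₂ := by
    rw [← Real.sin_pi_div_six]
    exact Real.sin_le_sin_of_le_of_le_pi_div_two (by linarith) hu₂ hl₂
  have hmv := Real.mul_rpow_neg_mul_sub_le ha0 hb0 hs
  have hKb : (16 * (K : ℝ)) ^ (-(s + 1)) ≤ b ^ (-(s + 1)) :=
    Real.rpow_le_rpow_of_nonpos hb0 hbK (by linarith)
  have hb1 : 0 < b ^ (-(s + 1)) := Real.rpow_pos_of_pos hb0 _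
  have h1 : s * (16 * (K : ℝ)) ^ (-(s + 1)) ≤ a ^ (-s) - b ^ (-s) := by
    refine le_trans ?_ hmv
    calc s * (16 * (K : ℝ)) ^ (-(s + 1)) ≤ s * b ^ (-(s + 1)) := by gcongr
      _ ≤ s * b ^ (-(s + 1)) * (b - a) := le_mul_of_one_le_right (by positivity) hab
  have h2 : 0 < s * (16 * (K : ℝ)) ^ (-(s + 1)) :=
    mul_pos hs (Real.rpow_pos_of_pos (by linarith) _)
  have h3 : a ^ (-s) * Real.sin θ₂ ≤ a ^ (-s) * Real.sin θ₁ := by gcongr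
  have h4 : (a ^ (-s) - b ^ (-s)) * (1 / 2) ≤ (a ^ (-s) - b ^ (-s)) * Real.sin θ₂ := by
    gcongr
    linarith
  linarith

/-- `spiral r s` contains `ε`-separated families with at least
`const * ε ^ (-(2 + s - r) / (1 + s))` members. -/
lemma exists_separated_family {r s : ℝ} (hr : 0 < r) (hs : 0 < s) {K : ℕ} (hK : 1 ≤ K) :
    ∃ (S : Finset (ℕ × ℕ)) (w : ℕ × ℕ → ℂ), (∀ i ∈ S, w i ∈ spiral r s) ∧
      (∀ i ∈ S, ∀ j ∈ S, i ≠ j → s / 2 * (16 * (K : ℝ)) ^ (-(s + 1)) ≤ dist (w i) (w j)) ∧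
      (16 * (K : ℝ)) ^ (2 + s - r) / (16 * s) ≤ S.card := by
  have hK0 : (0 : ℝ) < K := by exact_mod_cast hK
  set X : ℝ := 16 * (K : ℝ) with hX
  have hX0 : 0 < X := by positivity
  set ε : ℝ := s / 2 * X ^ (-(s + 1)) with hε
  have hε0 : 0 < ε := by positivity
  set M : ℕ := ⌊X ^ (-r) / 2 / ε⌋₊ with hM
  have hx : ∀ j ∈ Finset.range (M + 1), (j : ℝ) * ε ≤ X ^ (-r) / 2 := by
    intro j hj
    rw [← le_div_iff₀ hε0]
    have : (j : ℝ) ≤ M := by exact_mod_cast Nat.lt_succ_iff.1 (Finset.mem_range.1 hj)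
    exact this.trans (Nat.floor_le (by positivity))
  set S : Finset (ℕ × ℕ) := Finset.Ico K (2 * K) ×ˢ Finset.range (M + 1) with hS
  have hex : ∀ i : ℕ × ℕ, ∃ θ : ℝ, i ∈ S → θ ∈ Icc (Real.pi / 6) (Real.pi / 2) ∧
      (2 * Real.pi * i.1 + θ) ^ (-r) * Real.cos θ = i.2 * ε := by
    intro i
    by_cases hi : i ∈ S
    · obtain ⟨h1, h2⟩ := Finset.mem_product.1 hi
      obtain ⟨h3, h4⟩ := Finset.mem_Ico.1 h1
      obtain ⟨θ, hθ, hθ'⟩ := exists_param_on_turn hr h4 (hK.trans h3) (x := i.2 * ε)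
        (by positivity) (hx _ h2)
      exact ⟨θ, fun _ => ⟨hθ, hθ'⟩⟩
    · exact ⟨0, fun h => absurd h hi⟩
  choose θ hθ using hex
  have hcos : ∀ (i : ℕ × ℕ), Real.cos (2 * Real.pi * i.1 + θ i) = Real.cos (θ i) := by
    intro i
    rw [← Real.cos_add_nat_mul_two_pi (θ i) i.1]
    ring_nf
  have hsin : ∀ (i : ℕ × ℕ), Real.sin (2 * Real.pi * i.1 + θ i) = Real.sin (θ i) := by
    intro i
    rw [← Real.sin_add_nat_mul_two_pi (θ i) i.1]
    ring_nf
  have hre : ∀ i ∈ S, (spiralPoint r s (2 * Real.pi * i.1 + θ i)).re = i.2 * ε := by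
    intro i hi
    rw [spiralPoint_re, hcos, (hθ i hi).2]
  refine ⟨S, fun i => spiralPoint r s (2 * Real.pi * i.1 + θ i), ?_, ?_, ?_⟩
  · intro i hi
    refine ⟨2 * Real.pi * i.1 + θ i, ?_, rfl⟩
    have h1 : K ≤ i.1 := (Finset.mem_Ico.1 (Finset.mem_product.1 hi).1).1
    have h2 : (1 : ℝ) ≤ i.1 := by exact_mod_cast hK.trans h1
    have h3 := (hθ i hi).1.1
    have := Real.pi_gt_three
    nlinarith
  · have key : ∀ i ∈ S, ∀ j ∈ S, i.2 = j.2 → i.1 < j.1 →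
        ε ≤ dist (spiralPoint r s (2 * Real.pi * i.1 + θ i))
          (spiralPoint r s (2 * Real.pi * j.1 + θ j)) := by
      intro i hi j hj h2 h1
      have hv := vertical_separation hr hs
        (hK.trans (Finset.mem_Ico.1 (Finset.mem_product.1 hi).1).1) h1
        (Finset.mem_Ico.1 (Finset.mem_product.1 hj).1).2 (hθ i hi).1 (hθ j hj).1
        (by rw [(hθ i hi).2, (hθ j hj).2, h2])
      rw [Complex.dist_eq]
      refine le_trans ?_ (Complex.abs_im_le_norm _)
      rw [Complex.sub_im, spiralPoint_im, spiralPoint_im, hsin, hsin]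
      exact hv.trans (le_abs_self _)
    intro i hi j hj hij
    by_cases h2 : i.2 = j.2
    · rcases lt_trichotomy i.1 j.1 with h1 | h1 | h1
      · exact key i hi j hj h2 h1
      · exact absurd (Prod.ext h1 h2) hij
      · rw [dist_comm]
        exact key j hj i hi h2.symm h1
    · rw [Complex.dist_eq]
      refine le_trans ?_ (Complex.abs_re_le_norm _)
      rw [Complex.sub_re, hre i hi, hre j hj, ← sub_mul, abs_mul, abs_of_pos hε0]
      refine le_mul_of_one_le_left hε0.le ?_
      have : (1 : ℤ) ≤ |(i.2 : ℤ) - j.2| := Int.one_le_abs (by omega)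
      exact_mod_cast this
  · have hcard : (S.card : ℝ) = K * (M + 1) := by
      simp only [hS, Finset.card_product, Nat.card_Ico, Finset.card_range]
      push_cast [Nat.cast_sub (show K ≤ 2 * K by omega)]
      ring
    rw [hcard]
    have hfl : X ^ (-r) / 2 / ε ≤ (M : ℝ) + 1 := (Nat.lt_floor_add_one _).le
    have hcalc : X ^ (2 + s - r) / (16 * s) = K * (X ^ (-r) / 2 / ε) := by
      have hK' : (K : ℝ) = X / 16 := by rw [hX]; ring
      have h1 : X ^ (2 + s - r) = X * X ^ (-r) * X ^ (s + 1) := by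
        rw [mul_comm X, ← Real.rpow_add_one hX0.ne', ← Real.rpow_add hX0]
        ring_nf
      have h2 : 0 < X ^ (s + 1) := Real.rpow_pos_of_pos hX0 _
      rw [hK', hε, h1, Real.rpow_neg hX0.le (s + 1)]
      field_simp
    rw [hcalc]
    gcongr

theorem holder_exponent_bound_box_large_p (p q r s α : ℝ) (f : ℂ → ℂ)
    (hp : 0 < p) (hpq : p ≤ q) (hp1 : 1 < p)
    (hr : 0 < r) (hrs : r ≤ s) (hr1 : r ≤ 1)
    (hα0 : 0 < α) (hα1 : α ≤ 1)
    (hsurj : f '' spiral p q = spiral r s)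
    (hf : HolderOnSet f α (spiral p q)) :
    α ≤ (1 + s) / (2 + s - r) := by
  obtain ⟨c, hc, hf⟩ := hf
  have hs : 0 < s := hr.trans_le hrs
  have hp' := sub_pos.2 hp1
  set L : ℝ := 2 + 2 / (p - 1) with hL
  have hL0 : 0 ≤ L := by positivity
  set A : ℝ := (s / 2 / c) ^ (1 / α) with hA
  have hA0 : 0 < A := Real.rpow_pos_of_pos (by positivity) _
  have hmain : ∀ K : ℕ, 1 ≤ K → (16 * (K : ℝ)) ^ (2 + s - r) ≤
      (16 * s * (L / A + 1)) * (16 * (K : ℝ)) ^ ((1 + s) / α) := by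
    intro K hK
    obtain ⟨S, w, hw, hsep, hcard⟩ := exists_separated_family hr hs hK
    have hK1 : (1 : ℝ) ≤ K := by exact_mod_cast hK
    set X : ℝ := 16 * (K : ℝ) with hX
    have hX1 : 1 ≤ X := by linarith
    have hX0 : 0 < X := by linarith
    have hpre : ∀ i, ∃ t : ℝ, i ∈ S → 1 < t ∧ f (spiralPoint p q t) = w i := by
      intro i
      by_cases hi : i ∈ S
      · have := hw i hi
        rw [← hsurj] at this
        obtain ⟨z, ⟨t, ht, rfl⟩, hz⟩ := this
        exact ⟨t, fun _ => ⟨ht, hz⟩⟩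
      · exact ⟨0, fun h => absurd h hi⟩
    choose t ht using hpre
    set δ : ℝ := A * X ^ (-((1 + s) / α)) with hδ
    have hδ0 : 0 < δ := mul_pos hA0 (Real.rpow_pos_of_pos hX0 _)
    have hδα : δ ^ α = s / 2 * X ^ (-(s + 1)) / c := by
      rw [hδ, Real.mul_rpow hA0.le (Real.rpow_pos_of_pos hX0 _).le, hA,
        ← Real.rpow_mul (by positivity), ← Real.rpow_mul hX0.le, one_div_mul_cancel hα0.ne',
        Real.rpow_one, neg_mul, div_mul_cancel₀ _ hα0.ne', add_comm 1 s]
      ring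
    have hN := card_le_of_separated S (fun i => spiralGauge p q (t i)) hL0 hδ0
      (fun i hi => spiralGauge_nonneg q hp1 (ht i hi).1)
      (fun i hi => spiralGauge_le hp1 hpq (ht i hi).1) (by
        intro i hi j hj hij
        refine le_trans ?_ (dist_spiralPoint_le hp1 hpq (ht i hi).1 (ht j hj).1)
        have h1 := hf _ ⟨t i, (ht i hi).1, rfl⟩ _ ⟨t j, (ht j hj).1, rfl⟩
        change dist (f (spiralPoint p q (t i))) (f (spiralPoint p q (t j))) ≤
          c * dist (spiralPoint p q (t i)) (spiralPoint p q (t j)) ^ α at h1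
        rw [(ht i hi).2, (ht j hj).2] at h1
        have h2 := (hsep i hi j hj hij).trans h1
        rw [← Real.rpow_le_rpow_iff hδ0.le dist_nonneg hα0, hδα, div_le_iff₀' hc]
        exact h2)
    have hX' : 1 ≤ X ^ ((1 + s) / α) := Real.one_le_rpow hX1 (by positivity)
    have hLδ : L / δ = L / A * X ^ ((1 + s) / α) := by
      rw [hδ, Real.rpow_neg hX0.le]
      field_simp
    rw [hLδ] at hN
    have h3 := hcard.trans hN
    rw [div_le_iff₀ (by positivity)] at h3
    refine h3.trans ?_
    calc (L / A * X ^ ((1 + s) / α) + 1) * (16 * s)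
        ≤ (L / A * X ^ ((1 + s) / α) + X ^ ((1 + s) / α)) * (16 * s) := by gcongr
      _ = _ := by ring
  have hexp := Real.le_of_rpow_le_const_mul_rpow hmain
  rw [le_div_iff₀ hα0] at hexp
  rw [le_div_iff₀ (by linarith)]
  linarith
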